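/- arXiv:2604.01571 — 2 statements merged into one kernel-verified Lean document; each statement's English description precedes it below -/
import Mathlib

section
/- Universal nonvanishing for n ≤ 4: For every natural number n ≤ 4 and every nonempty set F of permutations of Fin n, the Vandermonde polynomial P_F(λ) = ∑_{σ ∈ F} sgn(σ) · ∏_{i=0}^{n−1} (λ + i)^{σ(i)} is not the zero polynomial of ℚ[λ]. -/
open Polynomial

/-- The Vandermonde polynomial of a finite family of permutations of `Fin n`:
`P_F(λ) = ∑_{σ ∈ F} sgn(σ) · ∏_{i=0}^{n−1} (λ + i)^{σ(i)}`. -/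
noncomputable def vand {n : ℕ} (F : Finset (Equiv.Perm (Fin n))) : Polynomial ℚ :=
  ∑ σ ∈ F, Polynomial.C ((Equiv.Perm.sign σ : ℤ) : ℚ) *
    ∏ i : Fin n, (Polynomial.X + Polynomial.C ((i : ℚ))) ^ ((σ i : ℕ))

/-- The value at `m` of the summand of `vand` attached to `σ`. -/
def vandTerm {n : ℕ} (m : ℤ) (σ : Equiv.Perm (Fin n)) : ℤ :=
  (Equiv.Perm.sign σ : ℤ) * ∏ i : Fin n, (m + (i : ℕ)) ^ (σ i : ℕ)

theorem sum_vandTerm_eq_zero {n : ℕ} {F : Finset (Equiv.Perm (Fin n))} (h : vand F = 0) (m : ℤ) :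
    ∑ σ ∈ F, vandTerm m σ = 0 := by
  have h_eval : (vand F).eval (m : ℚ) = 0 := by rw [h, eval_zero]
  simp only [vand, eval_finsetSum, eval_mul, eval_C, eval_prod, eval_pow, eval_add, eval_X]
    at h_eval
  simp only [vandTerm]
  exact_mod_cast h_eval

theorem exists_sum_vandTerm_ne_zero {n : ℕ} (hn : n ≤ 3) (F : Finset (Equiv.Perm (Fin n)))
    (hF : F.Nonempty) : ∃ m ∈ ([0, -1, -2, 1, -3] : List ℤ), ∑ σ ∈ F, vandTerm m σ ≠ 0 := by
  revert F
  interval_cases n <;> decide +kernel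

/-- The permutations of `Fin 4`, listed by their successive preimages; `permFour (a, b, c)`
sends `a` to `0`. -/
def permFour (t : Fin 4 × Fin 3 × Fin 2) : Equiv.Perm (Fin 4) :=
  (Equiv.swap 0 t.1 * Equiv.swap 1 t.2.1.succ * Equiv.swap 2 t.2.2.succ.succ)⁻¹

theorem permFour_bijective : Function.Bijective permFour := by
  decide +kernel

/-- The contribution to the value at `m` of those permutations sending `a` to `0` which are
selected by `y`. -/
def classSum (m : ℤ) (a : Fin 4) (y : Fin 3 → Fin 2 → Bool) : ℤ :=
  ∑ b, ∑ c, bif y b c then vandTerm m (permFour (a, b, c)) else 0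

theorem sum_vandTerm_eq_sum_classSum (F : Finset (Equiv.Perm (Fin 4))) (m : ℤ) :
    ∑ σ ∈ F, vandTerm m σ =
      ∑ a, classSum m a fun b c => decide (permFour (a, b, c) ∈ F) := by
  rw [← Finset.sum_ite_mem_eq, ← permFour_bijective.sum_comp, Fintype.sum_prod_type]
  simp [classSum, Fintype.sum_prod_type, Bool.cond_decide]

theorem classSum_neg_of_ne {k a : Fin 4} (hak : a ≠ k) (y : Fin 3 → Fin 2 → Bool) :
    classSum (-(k : ℕ)) a y = 0 := by
  have h : ∀ k a : Fin 4, a ≠ k → ∀ b c, vandTerm (-(k : ℕ)) (permFour (a, b, c)) = 0 := by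
    decide +kernel
  simp [classSum, h k a hak]

theorem classSum_self_eq_zero {F : Finset (Equiv.Perm (Fin 4))} (h : vand F = 0) (a : Fin 4) :
    classSum (-(a : ℕ)) a (fun b c => decide (permFour (a, b, c) ∈ F)) = 0 := by
  rw [← sum_vandTerm_eq_zero h (-(a : ℕ)), sum_vandTerm_eq_sum_classSum, eq_comm]
  exact Fintype.sum_eq_single a fun _ hb => classSum_neg_of_ne hb _

/-- The nonzero values taken by `(classSum 1 a y, classSum (-4) a y)` when
`classSum (-a) a y = 0`. -/
def classValues : Fin 4 → List (ℤ × ℤ) :=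
  ![[(-96, 24)],
    [(-120, 0), (384, -96), (552, 192), (-216, 144)],
    [(0, -120), (-96, 384), (192, 552), (144, -216)],
    [(24, -96)]]

theorem classSum_mem_classValues : ∀ (a : Fin 4) y, classSum (-(a : ℕ)) a y = 0 →
    y = (fun _ _ => false) ∨ (classSum 1 a y, classSum (-4) a y) ∈ classValues a := by
  decide +kernel

theorem eq_zero_of_mem_classValues : ∀ p₀ ∈ (0, 0) :: classValues 0,
    ∀ p₁ ∈ (0, 0) :: classValues 1, ∀ p₂ ∈ (0, 0) :: classValues 2,
    ∀ p₃ ∈ (0, 0) :: classValues 3, p₀ + p₁ + p₂ + p₃ = 0 →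
    p₀ = 0 ∧ p₁ = 0 ∧ p₂ = 0 ∧ p₃ = 0 := by
  decide +kernel

theorem zero_not_mem_classValues : ∀ a, (0 : ℤ × ℤ) ∉ classValues a := by
  decide +kernel

theorem vand_four_ne_zero {F : Finset (Equiv.Perm (Fin 4))} (hF : F.Nonempty) : vand F ≠ 0 := by
  intro h
  let y (a : Fin 4) (b : Fin 3) (c : Fin 2) : Bool := decide (permFour (a, b, c) ∈ F)
  let p (a : Fin 4) : ℤ × ℤ := (classSum 1 a (y a), classSum (-4) a (y a))
  have h_cases (a : Fin 4) : y a = (fun _ _ => false) ∨ p a ∈ classValues a :=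
    classSum_mem_classValues a (y a) (classSum_self_eq_zero h a)
  have h_mem (a : Fin 4) : p a ∈ (0, 0) :: classValues a := by
    rcases h_cases a with ha | ha
    · simp [p, ha, classSum]
    · exact List.mem_cons_of_mem _ ha
  have h_sum : p 0 + p 1 + p 2 + p 3 = 0 := by
    have h_one := sum_vandTerm_eq_zero h 1
    have h_neg_four := sum_vandTerm_eq_zero h (-4)
    rw [sum_vandTerm_eq_sum_classSum, Fin.sum_univ_four] at h_one h_neg_four
    exact Prod.ext h_one h_neg_four
  clear_value p
  have h_zero (a : Fin 4) : p a = 0 := by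
    obtain ⟨h₀, h₁, h₂, h₃⟩ := eq_zero_of_mem_classValues _ (h_mem 0) _ (h_mem 1) _ (h_mem 2) _
      (h_mem 3) h_sum
    match a with
    | 0 => exact h₀
    | 1 => exact h₁
    | 2 => exact h₂
    | 3 => exact h₃
  obtain ⟨σ, hσ⟩ := hF
  obtain ⟨⟨a, b, c⟩, rfl⟩ := permFour_bijective.surjective σ
  rcases h_cases a with ha | ha
  · simpa [y, hσ] using congrFun (congrFun ha b) c
  · rw [h_zero a] at ha
    exact zero_not_mem_classValues a ha

/-- Universal nonvanishing for `n ≤ 4`: the Vandermonde polynomial of every nonempty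
family of permutations of `Fin n` is nonzero. -/
theorem universal_nonvanishing_small (n : ℕ) (hn : n ≤ 4)
    (F : Finset (Equiv.Perm (Fin n))) (hF : F.Nonempty) :
    vand F ≠ 0 := by
  rcases Nat.lt_or_eq_of_le hn with hlt | rfl
  · intro h
    obtain ⟨m, -, hm⟩ := exists_sum_vandTerm_ne_zero (Nat.le_of_lt_succ hlt) F hF
    exact hm (sum_vandTerm_eq_zero h m)
  · exact vand_four_ne_zero hF
end

section
/- ASNC for biwheels: Let m ≥ 3 and let B_{2m} be the biwheel graph on rows and columns Fin m. For every coloring ρ : Fin m × Fin m → {0,1} and every t ∈ ℕ, if the exact-t fiber F = F_{B_{2m}, t} is nonempty, then the Vandermonde polynomial P_F(λ) = ∑_{σ ∈ F} sgn(σ) · ∏_{i=0}^{m−1} (λ + i)^{σ(i)} is not the zero polynomial of ℚ[λ]. -/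
open Polynomial

/-- The perfect matchings of the bipartite graph with edge set `E ⊆ Fin n × Fin n`. -/
def pm {n : ℕ} (E : Finset (Fin n × Fin n)) : Finset (Equiv.Perm (Fin n)) :=
  Finset.univ.filter (fun σ => ∀ i, (i, σ i) ∈ E)

/-- The exact-`t` fiber: perfect matchings whose red count is exactly `t`. -/
def fiber {n : ℕ} (E : Finset (Fin n × Fin n)) (ρ : Fin n × Fin n → Fin 2) (t : ℕ) :
    Finset (Equiv.Perm (Fin n)) :=
  (pm E).filter (fun σ => ∑ i, (ρ (i, σ i) : ℕ) = t)

/-- The edge set of the biwheel `B_{2m}`: row hub `(0, j)` for all `j`; column hub `(i, 0)`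
for all `i`; and rim edges `(i, i)` and `(i, succ i)` for `1 ≤ i ≤ m−1`, where
`succ i = i + 1` for `1 ≤ i ≤ m−2` and `succ (m−1) = 1`. -/
def biwheelEdges (m : ℕ) : Finset (Fin m × Fin m) :=
  Finset.univ.filter (fun p =>
    (p.1 : ℕ) = 0 ∨ (p.2 : ℕ) = 0 ∨
    (1 ≤ (p.1 : ℕ) ∧ ((p.2 : ℕ) = (p.1 : ℕ) ∨
      (p.2 : ℕ) = (if (p.1 : ℕ) = m - 1 then 1 else (p.1 : ℕ) + 1))))

namespace Biwheel

/-- The cyclic successor on `{1, …, n + 2}`. -/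
def cycSucc (n l : ℕ) : ℕ := if l = n + 2 then 1 else l + 1

/-- `σ` is a perfect matching of the biwheel with `n + 3` rows. -/
def IsMatching {n : ℕ} (σ : Equiv.Perm (Fin (n + 3))) : Prop :=
  ∀ i, i = 0 ∨ σ i = 0 ∨ (σ i : ℕ) = i ∨ (σ i : ℕ) = cycSucc n i

theorem isMatching_of_mem_pm {n : ℕ} {σ : Equiv.Perm (Fin (n + 3))}
    (h : σ ∈ pm (biwheelEdges (n + 3))) : IsMatching σ := by
  intro i
  have hi := (Finset.mem_filter.1 h).2 i
  simp only [biwheelEdges, Finset.mem_filter, Finset.mem_univ, true_and] at hi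
  simp only [cycSucc, Fin.ext_iff, Fin.val_zero]
  have : n + 3 - 1 = n + 2 := by omega
  rw [this] at hi
  tauto

theorem cycSucc_induction {n : ℕ} {Q : ℕ → Prop} {p : ℕ} (hp1 : 1 ≤ p) (hpn : p ≤ n + 2)
    (hp : Q p) (hQ : ∀ l, 1 ≤ l → l ≤ n + 2 → Q l → Q (cycSucc n l)) :
    ∀ q, 1 ≤ q → q ≤ n + 2 → Q q := by
  have up : ∀ a, 1 ≤ a → Q a → ∀ q, a ≤ q → q ≤ n + 2 → Q q := by
    intro a ha hQa q hq
    induction q, hq using Nat.le_induction with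
    | base => exact fun _ => hQa
    | succ q hq ih =>
      intro hqn
      have := hQ q (by omega) (by omega) (ih (by omega))
      rwa [cycSucc, if_neg (by omega)] at this
  have h1 : Q 1 := by
    have := hQ (n + 2) (by omega) le_rfl (up p hp1 hp _ hpn le_rfl)
    rwa [cycSucc, if_pos rfl] at this
  exact up 1 le_rfl h1

/-- Two matchings agreeing at both hubs that differ at one rim row differ at every rim row. -/
theorem forall_rim_of_rim {n : ℕ} {σ τ : Equiv.Perm (Fin (n + 3))} (hσ : IsMatching σ)
    (hτ : IsMatching τ) (h0 : σ 0 = τ 0) {k : Fin (n + 3)} (hσk : σ k = 0) (hτk : τ k = 0)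
    {p : Fin (n + 3)} (hp : p ≠ 0) (hσp : (σ p : ℕ) = p) (hτp : (τ p : ℕ) = cycSucc n p)
    (q : Fin (n + 3)) (hq : q ≠ 0) : (σ q : ℕ) = q ∧ (τ q : ℕ) = cycSucc n q := by
  have pos : ∀ {x : Fin (n + 3)}, x ≠ 0 → 1 ≤ (x : ℕ) := fun hx =>
    Nat.one_le_iff_ne_zero.2 fun h => hx (Fin.ext h)
  have key := cycSucc_induction (n := n)
    (Q := fun l => ∀ h : l < n + 3, (σ ⟨l, h⟩ : ℕ) = l ∧ (τ ⟨l, h⟩ : ℕ) = cycSucc n l)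
    (p := p) (pos hp) (by omega) (fun _ => ⟨hσp, hτp⟩) ?_
  · exact key q (pos hq) (by omega) q.2
  intro l hl1 hln hl h
  obtain ⟨hσl, hτl⟩ := hl (by omega)
  set q : Fin (n + 3) := ⟨cycSucc n l, h⟩ with hqdef
  set r : Fin (n + 3) := ⟨l, by omega⟩ with hrdef
  have hqv : (q : ℕ) = cycSucc n l := rfl
  have hq0 : q ≠ 0 := by
    intro h; have := congrArg Fin.val h
    simp only [hqv, cycSucc, Fin.val_zero] at this; split_ifs at this
  have hr0 : r ≠ 0 := by intro h; have := congrArg Fin.val h; simp [hrdef] at this; omega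
  have hqr : q ≠ r := by
    intro h; have := congrArg Fin.val h
    simp only [hqv, cycSucc, hrdef] at this; split_ifs at this <;> omega
  have hτr : τ r = q := Fin.ext hτl
  have hσr : σ r = r := Fin.ext hσl
  have hσq : σ q = q := by
    obtain ⟨x, hx⟩ := σ.surjective q
    rcases hσ x with h | h | h | h
    · subst h
      exact absurd (τ.injective (hτr.trans (hx.symm.trans h0))) hr0
    · exact absurd (hx.symm.trans h) hq0
    · rw [hx] at h
      rwa [← Fin.ext h] at hx
    · rw [hx, hqv] at h
      by_cases hx0 : x = 0
      · subst hx0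
        exact absurd (τ.injective (hτr.trans (hx.symm.trans h0))) hr0
      have hx1 := pos hx0
      have hxr : x = r := by
        apply Fin.ext
        simp only [cycSucc, hrdef] at h ⊢
        split_ifs at h <;> omega
      rw [hxr, hσr] at hx
      exact absurd hx.symm hqr
  refine ⟨congrArg Fin.val hσq, ?_⟩
  rcases hτ q with h | h | h | h
  · exact absurd h hq0
  · have := τ.injective (h.trans hτk.symm)
    rw [← this, hσq] at hσk
    exact absurd hσk hq0
  · exact absurd (τ.injective ((Fin.ext h : τ q = q).trans hτr.symm)) hqr
  · exact h

/-- Either two matchings agreeing at both hubs coincide, or they are the two rim matchings. -/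
theorem eq_or_rim {n : ℕ} {σ τ : Equiv.Perm (Fin (n + 3))} (hσ : IsMatching σ)
    (hτ : IsMatching τ) (h0 : σ 0 = τ 0) {k : Fin (n + 3)} (hσk : σ k = 0) (hτk : τ k = 0) :
    σ = τ ∨ (∀ q, q ≠ 0 → (σ q : ℕ) = q ∧ (τ q : ℕ) = cycSucc n q) ∨
      (∀ q, q ≠ 0 → (τ q : ℕ) = q ∧ (σ q : ℕ) = cycSucc n q) := by
  by_cases hst : σ = τ
  · exact Or.inl hst
  obtain ⟨p, hp⟩ : ∃ p, σ p ≠ τ p := by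
    by_contra! h
    exact hst (Equiv.ext h)
  have hp0 : p ≠ 0 := by rintro rfl; exact hp h0
  have hσp : σ p ≠ 0 := fun h => by
    have := σ.injective (h.trans hσk.symm)
    subst this; exact hp (hσk.trans hτk.symm)
  have hτp : τ p ≠ 0 := fun h => by
    have := τ.injective (h.trans hτk.symm)
    subst this; exact hp (hσk.trans hτk.symm)
  have hv : (σ p : ℕ) ≠ τ p := fun h => hp (Fin.ext h)
  rcases (hσ p).resolve_left hp0 |>.resolve_left hσp with h | h <;>
    rcases (hτ p).resolve_left hp0 |>.resolve_left hτp with h' | h'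
  · exact absurd (h.trans h'.symm) hv
  · exact Or.inr (Or.inl (forall_rim_of_rim hσ hτ h0 hσk hτk hp0 h h'))
  · exact Or.inr (Or.inr (forall_rim_of_rim hτ hσ h0.symm hτk hσk hp0 h' h))
  · exact absurd (h.trans h'.symm) hv

/-- A matching using both hub edges outside the corner is determined by them. -/
theorem eq_of_hubs {n : ℕ} {σ τ : Equiv.Perm (Fin (n + 3))} (hσ : IsMatching σ)
    (hτ : IsMatching τ) (h0 : σ 0 = τ 0) {k : Fin (n + 3)} (hk : k ≠ 0) (hσk : σ k = 0)
    (hτk : τ k = 0) : σ = τ := by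
  have hk' : (k : ℕ) ≠ 0 := fun h => hk (Fin.ext h)
  rcases eq_or_rim hσ hτ h0 hσk hτk with h | h | h
  · exact h
  · have := (h k hk).1
    rw [hσk] at this
    exact absurd this.symm hk'
  · have := (h k hk).1
    rw [hτk] at this
    exact absurd this.symm hk'

theorem prod_mul_swap {ι : Type*} [Fintype ι] [DecidableEq ι] (s : Finset ι) (w : ι → ℚ)
    (e : ι → ℕ) {a b : ι} (ha : a ∈ s) (hb : b ∈ s) (hab : a ≠ b) :
    (∏ l ∈ s, w l ^ e (Equiv.swap a b l)) * (w a ^ e a * w b ^ e b) =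
      (∏ l ∈ s, w l ^ e l) * (w a ^ e b * w b ^ e a) := by
  have hb' : b ∈ s.erase a := Finset.mem_erase.2 ⟨hab.symm, hb⟩
  rw [← Finset.mul_prod_erase s _ ha, ← Finset.mul_prod_erase _ _ hb',
    ← Finset.mul_prod_erase s (fun l => w l ^ e l) ha, ← Finset.mul_prod_erase _ _ hb',
    Equiv.swap_apply_left, Equiv.swap_apply_right]
  have : ∏ x ∈ (s.erase a).erase b, w x ^ e (Equiv.swap a b x) =
      ∏ x ∈ (s.erase a).erase b, w x ^ e x := by
    refine Finset.prod_congr rfl fun x hx => ?_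
    rw [Finset.mem_erase, Finset.mem_erase] at hx
    rw [Equiv.swap_apply_of_ne_of_ne hx.2.1 hx.1]
  rw [this]
  ring

/-- The signed contribution of `σ` to the Vandermonde polynomial at `-k`. -/
def signedTerm {n : ℕ} (k : Fin (n + 3)) (σ : Equiv.Perm (Fin (n + 3))) : ℚ :=
  ((Equiv.Perm.sign σ : ℤ) : ℚ) * ∏ i : Fin (n + 3), ((i : ℚ) - k) ^ (σ i : ℕ)

theorem signedTerm_ne_zero {n : ℕ} {k : Fin (n + 3)} {σ : Equiv.Perm (Fin (n + 3))}
    (hk : σ k = 0) : signedTerm k σ ≠ 0 := by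
  refine mul_ne_zero (by simp) (Finset.prod_ne_zero_iff.2 fun i _ => ?_)
  by_cases h : i = k
  · subst h; simp [hk]
  · refine pow_ne_zero _ (sub_ne_zero.2 fun h' => h (Fin.ext ?_))
    exact_mod_cast h'

theorem exists_last_column {n : ℕ} {k : Fin (n + 3)} (hk : k ≠ 0) :
    ∀ d : ℕ, ∀ σ : Equiv.Perm (Fin (n + 3)), IsMatching σ → σ k = 0 → k < σ 0 →
      (σ 0 : ℕ) + d = n + 2 →
      ∃ τ : Equiv.Perm (Fin (n + 3)), IsMatching τ ∧ τ k = 0 ∧ (τ 0 : ℕ) = n + 2 ∧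
        0 < signedTerm k σ * signedTerm k τ := by
  have hk1 : 1 ≤ (k : ℕ) := Nat.one_le_iff_ne_zero.2 fun h => hk (Fin.ext h)
  intro d
  induction d with
  | zero =>
    intro σ hσ hσk _ hd
    exact ⟨σ, hσ, hσk, hd, mul_self_pos.2 (signedTerm_ne_zero hσk)⟩
  | succ d ih =>
    intro σ hσ hσk hlt hd
    set j := σ 0 with hj
    have hlt' : (k : ℕ) < j := hlt
    have hj0 : j ≠ 0 := fun h => by rw [h] at hlt'; simp at hlt'
    have hσj : (σ j : ℕ) = j + 1 := by
      rcases hσ j with h | h | h | h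
      · exact absurd h hj0
      · exact absurd (σ.injective (h.trans hσk.symm)) (ne_of_gt hlt)
      · exact absurd (σ.injective ((Fin.ext h : σ j = j).trans hj)) hj0
      · rwa [cycSucc, if_neg (by omega)] at h
    set τ := σ * Equiv.swap 0 j with hτ
    have hτ0 : τ 0 = σ j := by simp [hτ]
    have hτj : τ j = j := by simp [hτ, ← hj]
    have hτne : ∀ x, x ≠ 0 → x ≠ j → τ x = σ x := fun x h h' => by
      simp [hτ, Equiv.swap_apply_of_ne_of_ne h h']
    have hτk : τ k = 0 := (hτne k hk (ne_of_lt hlt)).trans hσk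
    have hτm : IsMatching τ := by
      intro x
      by_cases h0 : x = 0
      · exact Or.inl h0
      by_cases hxj : x = j
      · subst hxj; exact Or.inr (Or.inr (Or.inl (congrArg Fin.val hτj)))
      · rw [hτne x h0 hxj]; exact hσ x
    obtain ⟨ρ, hρ, hρk, hρ0, hpos⟩ := ih τ hτm hτk
      (by rw [hτ0, Fin.lt_def, hσj]; omega) (by rw [hτ0, hσj]; omega)
    refine ⟨ρ, hρ, hρk, hρ0, ?_⟩
    have hrel : signedTerm k τ * ((j : ℚ) - k) = signedTerm k σ * k := by
      have hprod := prod_mul_swap Finset.univ (fun i : Fin (n + 3) => (i : ℚ) - k)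
        (fun i => (σ i : ℕ)) (Finset.mem_univ 0) (Finset.mem_univ j) (Ne.symm hj0)
      have hsign : ((Equiv.Perm.sign τ : ℤ) : ℚ) = -((Equiv.Perm.sign σ : ℤ) : ℚ) := by
        rw [hτ, Equiv.Perm.sign_mul, Equiv.Perm.sign_swap (Ne.symm hj0)]
        simp
      simp only [← hj, hσj] at hprod
      have hjk : (j : ℚ) - k ≠ 0 := by
        have : ((k : ℕ) : ℚ) < (j : ℕ) := by exact_mod_cast hlt'
        exact (sub_pos.2 this).ne'
      have hkq : ((0 : Fin (n + 3)) : ℕ) - ((k : ℕ) : ℚ) ≠ 0 := by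
        simp [show (k : ℕ) ≠ 0 by omega]
      have hc : (((0 : Fin (n + 3)) : ℕ) - ((k : ℕ) : ℚ)) ^ (j : ℕ) * ((j : ℚ) - k) ^ (j : ℕ) ≠ 0 :=
        mul_ne_zero (pow_ne_zero _ hkq) (pow_ne_zero _ hjk)
      have hτe : ∏ i : Fin (n + 3), ((i : ℚ) - k) ^ (τ i : ℕ) =
          ∏ i : Fin (n + 3), ((i : ℚ) - k) ^ (σ (Equiv.swap 0 j i) : ℕ) := rfl
      rw [signedTerm, signedTerm, hsign, hτe]
      apply mul_left_cancel₀ hc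
      rw [pow_succ, pow_succ] at hprod
      have h00 : (((0 : Fin (n + 3)) : ℕ) : ℚ) = 0 := by simp
      rw [h00] at hprod ⊢
      linear_combination (-((Equiv.Perm.sign σ : ℤ) : ℚ)) * hprod
    have hjk : (0 : ℚ) < (j : ℚ) - k := sub_pos.2 (by exact_mod_cast hlt')
    have hkq : (0 : ℚ) < k := by exact_mod_cast hk1
    have h1 : 0 < signedTerm k τ * ((j : ℚ) - k) * signedTerm k ρ := by
      have := mul_pos hpos hjk
      linarith [this, mul_right_comm (signedTerm k τ) (signedTerm k ρ) ((j : ℚ) - k)]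
    rw [hrel, mul_right_comm] at h1
    exact pos_of_mul_pos_left h1 hkq.le

/-- The contributions at `-k` of matchings through row `k` and column `> k` have equal sign. -/
theorem signedTerm_mul_pos {n : ℕ} {k : Fin (n + 3)} (hk : k ≠ 0)
    {σ τ : Equiv.Perm (Fin (n + 3))} (hσ : IsMatching σ) (hτ : IsMatching τ) (hσk : σ k = 0)
    (hτk : τ k = 0) (hσ0 : k < σ 0) (hτ0 : k < τ 0) :
    0 < signedTerm k σ * signedTerm k τ := by
  obtain ⟨σ', h1, h2, h3, h4⟩ := exists_last_column hk (n + 2 - σ 0) σ hσ hσk hσ0 (by omega)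
  obtain ⟨τ', k1, k2, k3, k4⟩ := exists_last_column hk (n + 2 - τ 0) τ hτ hτk hτ0 (by omega)
  obtain rfl : σ' = τ' := eq_of_hubs h1 k1 (Fin.ext (h3.trans k3.symm)) hk h2 k2
  have h5 := mul_pos h4 k4
  have h6 : 0 < signedTerm k σ * signedTerm k τ * (signedTerm k σ') ^ 2 := by
    calc (0 : ℚ) < _ := h5
      _ = _ := by ring
  exact pos_of_mul_pos_left h6 (sq_nonneg _)

theorem eval_vand {n : ℕ} (F : Finset (Equiv.Perm (Fin (n + 3)))) (k : Fin (n + 3)) :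
    (vand F).eval (-(k : ℚ)) = ∑ σ ∈ F with σ k = 0, signedTerm k σ := by
  rw [vand, eval_finsetSum, Finset.sum_filter]
  refine Finset.sum_congr rfl fun σ _ => ?_
  simp only [eval_mul, eval_C, eval_prod, eval_pow, eval_add, eval_X]
  split_ifs with h
  · rw [signedTerm]
    congr 1
    exact Finset.prod_congr rfl fun i _ => by ring
  · rw [Finset.prod_eq_zero (Finset.mem_univ k), mul_zero]
    rw [neg_add_cancel, zero_pow]
    exact fun h' => h (Fin.ext h')

/-- If some matching of `F` through row `k` exists and all of them use a column `> k`, then the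
Vandermonde polynomial does not vanish at `-k`. -/
theorem vand_ne_zero_of_row {n : ℕ} {F : Finset (Equiv.Perm (Fin (n + 3)))}
    (hF : ∀ σ ∈ F, IsMatching σ) {k : Fin (n + 3)} (hk : k ≠ 0)
    (hrow : ∀ σ ∈ F, σ k = 0 → k < σ 0) {σ : Equiv.Perm (Fin (n + 3))} (hσ : σ ∈ F)
    (hσk : σ k = 0) : vand F ≠ 0 := by
  intro h
  have h1 := eval_vand F k
  rw [h, eval_zero] at h1
  have h2 : 0 < ∑ τ ∈ F with τ k = 0, signedTerm k σ * signedTerm k τ := by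
    refine Finset.sum_pos (fun τ hτ => ?_) ⟨σ, Finset.mem_filter.2 ⟨hσ, hσk⟩⟩
    obtain ⟨hτF, hτk⟩ := Finset.mem_filter.1 hτ
    exact signedTerm_mul_pos hk (hF σ hσ) (hF τ hτF) hσk hτk (hrow σ hσ hσk) (hrow τ hτF hτk)
  rw [← Finset.mul_sum, ← h1, mul_zero] at h2
  exact lt_irrefl _ h2

/-- The product of the nonzero row weights of `σ` at the point `0`. -/
def weight {n : ℕ} (σ : Equiv.Perm (Fin (n + 3))) : ℚ :=
  ∏ i ∈ Finset.univ.erase (0 : Fin (n + 3)), (i : ℚ) ^ (σ i : ℕ)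

theorem weight_pos {n : ℕ} (σ : Equiv.Perm (Fin (n + 3))) : 0 < weight σ := by
  refine Finset.prod_pos fun i hi => pow_pos ?_ _
  have : (i : ℕ) ≠ 0 := fun h => Finset.ne_of_mem_erase hi (Fin.ext h)
  exact_mod_cast Nat.pos_of_ne_zero this

/-- Vanishing of the Vandermonde polynomial forces cancellation in the lowest column. -/
theorem sum_weight_eq_zero {n : ℕ} {F : Finset (Equiv.Perm (Fin (n + 3)))} (h : vand F = 0)
    (j : Fin (n + 3)) (hj : ∀ σ ∈ F, j ≤ σ 0) :
    ∑ σ ∈ F with σ 0 = j, ((Equiv.Perm.sign σ : ℤ) : ℚ) * weight σ = 0 := by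
  set R : ℚ[X] := ∑ σ ∈ F, C ((Equiv.Perm.sign σ : ℤ) : ℚ) * (X ^ ((σ 0 : ℕ) - j) *
    ∏ i ∈ Finset.univ.erase 0, (X + C ((i : Fin (n + 3)) : ℚ)) ^ (σ i : ℕ)) with hR
  have hfac : vand F = X ^ (j : ℕ) * R := by
    rw [vand, hR, Finset.mul_sum]
    refine Finset.sum_congr rfl fun σ hσ => ?_
    rw [← Finset.mul_prod_erase Finset.univ _ (Finset.mem_univ 0)]
    have : (σ 0 : ℕ) = j + ((σ 0 : ℕ) - j) := (Nat.add_sub_cancel' (hj σ hσ)).symm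
    have hx : (X + C (((0 : Fin (n + 3)) : ℕ) : ℚ)) ^ (σ 0 : ℕ) =
        (X : ℚ[X]) ^ (j : ℕ) * X ^ ((σ 0 : ℕ) - j) := by
      rw [← pow_add, ← this]; simp
    rw [hx]
    ring
  have hR0 : R = 0 := by
    rw [h] at hfac
    exact (mul_eq_zero.1 hfac.symm).resolve_left (pow_ne_zero _ X_ne_zero)
  have hev := congrArg (eval 0) hR0
  rw [eval_zero, hR, eval_finsetSum] at hev
  rw [← hev, Finset.sum_filter]
  refine Finset.sum_congr rfl fun σ hσ => ?_
  simp only [eval_mul, eval_C, eval_prod, eval_pow, eval_add, eval_X, zero_add]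
  split_ifs with h0
  · simp [h0, weight]
  · have hlt : (j : ℕ) < σ 0 := lt_of_le_of_ne (hj σ hσ) (fun h => h0 (Fin.ext h.symm))
    rw [zero_pow (by omega)]
    simp

theorem sum_sign_mul_ne_zero_of_dominant {α : Type*} [DecidableEq α] {S : Finset α}
    {ε : α → ℤˣ} {w : α → ℚ} (hw : ∀ x ∈ S, 0 ≤ w x) {a : α} (ha : a ∈ S)
    (hdom : ∑ x ∈ S.erase a, w x < w a) : ∑ x ∈ S, ((ε x : ℤ) : ℚ) * w x ≠ 0 := by
  have habs : ∀ x ∈ S, |((ε x : ℤ) : ℚ) * w x| = w x := fun x hx => by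
    rw [abs_mul, abs_of_nonneg (hw x hx)]
    rcases Int.units_eq_one_or (ε x) with h | h <;> simp [h]
  intro h
  rw [← Finset.add_sum_erase S _ ha] at h
  have h1 := congrArg abs (eq_neg_of_add_eq_zero_left h)
  rw [habs a ha, abs_neg] at h1
  have h2 := Finset.abs_sum_le_sum_abs (fun x => ((ε x : ℤ) : ℚ) * w x) (S.erase a)
  rw [Finset.sum_congr rfl fun x hx => habs x (Finset.mem_of_mem_erase hx)] at h2
  linarith

theorem two_mul_pow_le (a : ℕ) (ha : 1 ≤ a) : 2 * (a : ℚ) ^ (a + 1) ≤ (a + 1 : ℚ) ^ (a + 1) := by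
  have ha' : (0 : ℚ) < a := by exact_mod_cast ha
  have h := one_add_mul_le_pow (a := (1 : ℚ) / a) (by have : (0:ℚ) < 1 / a := by positivity
                                                      linarith) (a + 1)
  have h2 : (2 : ℚ) ≤ (1 + 1 / (a : ℚ)) ^ (a + 1) := by
    refine le_trans ?_ h
    push_cast
    have : ((a : ℚ) + 1) * (1 / a) = 1 + 1 / a := by field_simp
    rw [this]
    have : (0:ℚ) < 1 / a := by positivity
    linarith
  calc 2 * (a : ℚ) ^ (a + 1) ≤ (1 + 1 / (a : ℚ)) ^ (a + 1) * (a : ℚ) ^ (a + 1) := by gcongr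
    _ = (a + 1 : ℚ) ^ (a + 1) := by
      rw [← mul_pow]; congr 1; field_simp

/-- In a fixed column `j`, lowering the row matched to column `0` by one, while it stays at least
`j`, at least doubles the weight. -/
theorem two_pow_mul_weight_le {n : ℕ} {j a : Fin (n + 3)} (hj : j ≠ 0) (hja : j ≤ a)
    {τ : Equiv.Perm (Fin (n + 3))} (hτ : IsMatching τ) (hτ0 : τ 0 = j) (hτa : τ a = 0) :
    ∀ d : ℕ, ∀ σ : Equiv.Perm (Fin (n + 3)), ∀ i : Fin (n + 3), IsMatching σ → σ 0 = j →
      σ i = 0 → (i : ℕ) = a + d → 2 ^ d * weight σ ≤ weight τ := by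
  have hj1 : 1 ≤ (j : ℕ) := Nat.one_le_iff_ne_zero.2 fun h => hj (Fin.ext h)
  have hja' : (j : ℕ) ≤ a := hja
  intro d
  induction d with
  | zero =>
    intro σ i hσ hσ0 hσi hi
    obtain rfl : i = a := Fin.ext hi
    have ha : i ≠ 0 := fun h => by rw [h] at hja'; simp at hja'; omega
    rw [eq_of_hubs hσ hτ (hσ0.trans hτ0.symm) ha hσi hτa]
    simp
  | succ d ih =>
    intro σ i hσ hσ0 hσi hi
    set p : Fin (n + 3) := ⟨a + d, by omega⟩ with hp
    have hpv : (p : ℕ) = a + d := rfl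
    have hi0 : i ≠ 0 := fun h => by rw [h] at hi; simp at hi
    have hp0 : p ≠ 0 := fun h => by
      have := congrArg Fin.val h
      rw [hpv, Fin.val_zero] at this
      omega
    have hpi : p ≠ i := fun h => by have := congrArg Fin.val h; omega
    have hσp : σ p = i := by
      obtain ⟨x, hx⟩ := σ.surjective i
      by_cases hx0 : x = 0
      · subst hx0
        rw [hσ0] at hx
        have := congrArg Fin.val hx
        omega
      rcases hσ x with h | h | h | h
      · exact absurd h hx0
      · exact absurd (hx.symm.trans h) hi0
      · rw [hx] at h
        rw [← Fin.ext h, hσi] at hx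
        exact absurd hx.symm hi0
      · rw [hx, cycSucc] at h
        have : x = p := by
          apply Fin.ext
          split_ifs at h <;> omega
        rw [← this, hx]
    set σ' := σ * Equiv.swap p i with hσ'
    have hσ'p : σ' p = 0 := by simp [hσ', hσi]
    have hσ'i : σ' i = i := by simp [hσ', hσp]
    have hσ'ne : ∀ x, x ≠ p → x ≠ i → σ' x = σ x := fun x h h' => by
      simp [hσ', Equiv.swap_apply_of_ne_of_ne h h']
    have hm : IsMatching σ' := by
      intro x
      by_cases hxp : x = p
      · subst hxp; exact Or.inr (Or.inl hσ'p)
      by_cases hxi : x = i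
      · subst hxi; exact Or.inr (Or.inr (Or.inl (congrArg Fin.val hσ'i)))
      · rw [hσ'ne x hxp hxi]; exact hσ x
    have hle := ih σ' p hm ((hσ'ne 0 hp0.symm hi0.symm).trans hσ0) hσ'p hpv
    have hprod := prod_mul_swap (Finset.univ.erase 0) (fun i : Fin (n + 3) => (i : ℚ))
        (fun i => (σ i : ℕ)) (Finset.mem_erase.2 ⟨hp0, Finset.mem_univ p⟩)
        (Finset.mem_erase.2 ⟨hi0, Finset.mem_univ i⟩) hpi
    have hiv : (i : ℕ) = p + 1 := by omega
    have hpq : (0 : ℚ) < (p : ℕ) := by exact_mod_cast (by omega : 0 < (p : ℕ))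
    change weight σ' * _ = weight σ * _ at hprod
    simp only [hσp, hσi, Fin.val_zero, pow_zero, mul_one, one_mul] at hprod
    rw [hiv] at hprod
    push_cast at hprod
    have hb := two_mul_pow_le (p : ℕ) (by omega)
    have h2 : 2 * weight σ ≤ weight σ' := by
      refine le_of_mul_le_mul_right ?_ (pow_pos hpq ((p : ℕ) + 1))
      rw [hprod]
      nlinarith [weight_pos σ]
    calc (2 : ℚ) ^ (d + 1) * weight σ = 2 ^ d * (2 * weight σ) := by ring
      _ ≤ 2 ^ d * weight σ' := by gcongr
      _ ≤ weight τ := hle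

/-- The shifted rim matching has smaller weight than the unshifted one. -/
theorem weight_shift_lt {n : ℕ} {σ τ : Equiv.Perm (Fin (n + 3))}
    (h : ∀ q, q ≠ 0 → (σ q : ℕ) = q ∧ (τ q : ℕ) = cycSucc n q) : weight τ < weight σ := by
  have hlast : Fin.last (n + 2) ∈ Finset.univ.erase (0 : Fin (n + 3)) :=
    Finset.mem_erase.2 ⟨by simp [Fin.ext_iff], Finset.mem_univ _⟩
  have hcard : (Finset.univ.erase (0 : Fin (n + 3))).card = n + 2 := by simp
  have h1 : weight τ * (n + 2 : ℚ) ^ (n + 2) =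
      weight σ * ∏ i ∈ Finset.univ.erase (0 : Fin (n + 3)), (i : ℚ) := by
    have : (n + 2 : ℚ) ^ (n + 2) = ∏ i ∈ Finset.univ.erase (0 : Fin (n + 3)),
        if i = Fin.last (n + 2) then (n + 2 : ℚ) ^ (n + 2) else 1 := by
      rw [Finset.prod_ite_eq' _ _ fun _ => (n + 2 : ℚ) ^ (n + 2), if_pos hlast]
    rw [this, weight, weight, ← Finset.prod_mul_distrib, ← Finset.prod_mul_distrib]
    refine Finset.prod_congr rfl fun i hi => ?_
    obtain ⟨hσi, hτi⟩ := h i (Finset.ne_of_mem_erase hi)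
    rw [hσi, hτi, cycSucc]
    by_cases hl : i = Fin.last (n + 2)
    · rw [if_pos hl, if_pos (by simp [hl]), hl]
      simp [mul_comm]
    · rw [if_neg hl, if_neg fun h' : (i : ℕ) = n + 2 => hl (Fin.ext h')]
      rw [pow_succ, mul_one]
  have h2 : ∏ i ∈ Finset.univ.erase (0 : Fin (n + 3)), (i : ℚ) < (n + 2 : ℚ) ^ (n + 2) := by
    have hconst := Finset.prod_const (s := Finset.univ.erase (0 : Fin (n + 3))) (n + 2 : ℚ)
    rw [hcard] at hconst
    rw [← hconst]
    refine Finset.prod_lt_prod (fun i hi => ?_) (fun i _ => ?_) ⟨1, ?_, ?_⟩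
    · have : (i : ℕ) ≠ 0 := fun h => Finset.ne_of_mem_erase hi (Fin.ext h)
      exact_mod_cast Nat.pos_of_ne_zero this
    · have := i.2
      exact_mod_cast (by omega : (i : ℕ) ≤ n + 2)
    · simp
    · have : (0 : ℚ) ≤ n := n.cast_nonneg
      simp only [Fin.val_one, Nat.cast_one]
      linarith
  have h3 : (0 : ℚ) < (n + 2 : ℚ) ^ (n + 2) := by positivity
  refine lt_of_mul_lt_mul_right ?_ h3.le
  rw [h1]
  exact mul_lt_mul_of_pos_left h2 (weight_pos σ)

theorem sum_sign_mul_weight_ne_zero_of_corner {n : ℕ} {S : Finset (Equiv.Perm (Fin (n + 3)))}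
    (hS : ∀ σ ∈ S, IsMatching σ ∧ σ 0 = 0) (hne : S.Nonempty) :
    ∑ σ ∈ S, ((Equiv.Perm.sign σ : ℤ) : ℚ) * weight σ ≠ 0 := by
  have hpair : ∀ σ ∈ S, ∀ τ ∈ S, σ = τ ∨
      (∀ q, q ≠ 0 → (σ q : ℕ) = q ∧ (τ q : ℕ) = cycSucc n q) ∨
      (∀ q, q ≠ 0 → (τ q : ℕ) = q ∧ (σ q : ℕ) = cycSucc n q) := fun σ hσ τ hτ =>
    eq_or_rim (hS σ hσ).1 (hS τ hτ).1 ((hS σ hσ).2.trans (hS τ hτ).2.symm) (hS σ hσ).2 (hS τ hτ).2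
  obtain ⟨a, ha, hmax⟩ := S.exists_max_image weight hne
  refine sum_sign_mul_ne_zero_of_dominant (fun σ _ => (weight_pos σ).le) ha ?_
  have hother : ∀ τ ∈ S, τ ≠ a → ∀ q, q ≠ 0 → (a q : ℕ) = q ∧ (τ q : ℕ) = cycSucc n q := by
    intro τ hτ hne
    rcases hpair a ha τ hτ with h | h | h
    · exact absurd h.symm hne
    · exact h
    · exact absurd (hmax τ hτ) (not_le.2 (weight_shift_lt h))
  rcases (S.erase a).eq_empty_or_nonempty with he | ⟨τ, hτ⟩
  · rw [he, Finset.sum_empty]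
    exact weight_pos a
  obtain ⟨hτa, hτS⟩ := Finset.mem_erase.1 hτ
  have : S.erase a = {τ} := by
    refine Finset.eq_singleton_iff_unique_mem.2 ⟨hτ, fun υ hυ => ?_⟩
    obtain ⟨hυa, hυS⟩ := Finset.mem_erase.1 hυ
    refine Equiv.ext fun q => ?_
    by_cases hq : q = 0
    · rw [hq, (hS υ hυS).2, (hS τ hτS).2]
    · exact Fin.ext ((hother υ hυS hυa q hq).2.trans (hother τ hτS hτa q hq).2.symm)
  rw [this, Finset.sum_singleton]
  exact weight_shift_lt (hother τ hτS hτa)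

theorem sum_sign_mul_weight_ne_zero_of_column {n : ℕ}
    {S : Finset (Equiv.Perm (Fin (n + 3)))} {j : Fin (n + 3)} (hj : j ≠ 0)
    (hS : ∀ σ ∈ S, IsMatching σ ∧ σ 0 = j ∧ j ≤ σ.symm 0) (hne : S.Nonempty) :
    ∑ σ ∈ S, ((Equiv.Perm.sign σ : ℤ) : ℚ) * weight σ ≠ 0 := by
  obtain ⟨a, ha, hmin⟩ := S.exists_min_image (fun σ => σ.symm 0) hne
  obtain ⟨ham, ha0, haj⟩ := hS a ha
  refine sum_sign_mul_ne_zero_of_dominant (fun σ _ => (weight_pos σ).le) ha ?_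
  have hrow0 : ∀ σ ∈ S, σ.symm 0 ≠ 0 := fun σ hσ h => by
    have := (hS σ hσ).2.2
    rw [h] at this
    exact hj (Fin.le_zero_iff.1 this)
  have hinj : Set.InjOn (fun σ : Equiv.Perm (Fin (n + 3)) => n + 3 - (σ.symm 0 : ℕ)) S := by
    intro σ hσ τ hτ h
    have hst : σ.symm 0 = τ.symm 0 := Fin.ext (by simp only at h; omega)
    exact eq_of_hubs (hS σ hσ).1 (hS τ hτ).1 ((hS σ hσ).2.1.trans (hS τ hτ).2.1.symm)
      (hrow0 σ hσ) (σ.apply_symm_apply 0) (by rw [hst]; exact τ.apply_symm_apply 0)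
  have hbound : ∀ σ ∈ S.erase a, weight σ * 2 ^ (n + 3 - (a.symm 0 : ℕ)) ≤
      weight a * ((2 ^ (n + 3 - (σ.symm 0 : ℕ)) : ℕ) : ℚ) := by
    intro σ hσ
    obtain ⟨-, hσS⟩ := Finset.mem_erase.1 hσ
    have hle : (a.symm 0 : ℕ) ≤ σ.symm 0 := hmin σ hσS
    have h := two_pow_mul_weight_le hj haj ham ha0 (a.apply_symm_apply 0)
      ((σ.symm 0 : ℕ) - a.symm 0) σ (σ.symm 0) (hS σ hσS).1 (hS σ hσS).2.1
      (σ.apply_symm_apply 0) (by omega)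
    have he : n + 3 - (a.symm 0 : ℕ) =
        ((σ.symm 0 : ℕ) - a.symm 0) + (n + 3 - (σ.symm 0 : ℕ)) := by omega
    rw [he, pow_add]
    push_cast
    calc _ = 2 ^ ((σ.symm 0 : ℕ) - a.symm 0) * weight σ * 2 ^ (n + 3 - (σ.symm 0 : ℕ)) := by ring
      _ ≤ _ := by gcongr
  have hgeom : ∑ σ ∈ S.erase a, 2 ^ (n + 3 - (σ.symm 0 : ℕ)) < 2 ^ (n + 3 - (a.symm 0 : ℕ)) := by
    have himg := Finset.sum_image (s := S.erase a) (f := fun k => 2 ^ k)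
      (g := fun σ : Equiv.Perm (Fin (n + 3)) => n + 3 - (σ.symm 0 : ℕ))
      (hinj.mono fun σ hσ => Finset.mem_of_mem_erase hσ)
    rw [← himg]
    refine Nat.geomSum_lt le_rfl fun k hk => ?_
    obtain ⟨σ, hσ, rfl⟩ := Finset.mem_image.1 hk
    obtain ⟨hσa, hσS⟩ := Finset.mem_erase.1 hσ
    have hle : (a.symm 0 : ℕ) ≤ σ.symm 0 := hmin σ hσS
    have hne : n + 3 - (σ.symm 0 : ℕ) ≠ n + 3 - (a.symm 0 : ℕ) := fun h => hσa (hinj hσS ha h)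
    omega
  have h2 : (0 : ℚ) < 2 ^ (n + 3 - (a.symm 0 : ℕ)) := by positivity
  refine lt_of_mul_lt_mul_right ?_ h2.le
  rw [Finset.sum_mul]
  calc _ ≤ ∑ σ ∈ S.erase a, weight a * ((2 ^ (n + 3 - (σ.symm 0 : ℕ)) : ℕ) : ℚ) :=
        Finset.sum_le_sum hbound
    _ < weight a * 2 ^ (n + 3 - (a.symm 0 : ℕ)) := by
      rw [← Finset.mul_sum]
      refine mul_lt_mul_of_pos_left ?_ (weight_pos a)
      exact_mod_cast hgeom

/-- The Vandermonde polynomial of any nonempty family of biwheel matchings is nonzero. -/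
theorem vand_ne_zero {n : ℕ} {F : Finset (Equiv.Perm (Fin (n + 3)))}
    (hF : ∀ σ ∈ F, IsMatching σ) (hne : F.Nonempty) : vand F ≠ 0 := by
  intro h
  obtain ⟨a, ha, hmin⟩ := F.exists_min_image (fun σ => σ 0) hne
  have hsum := sum_weight_eq_zero h (a 0) hmin
  have hS : (F.filter fun σ => σ 0 = a 0).Nonempty := ⟨a, Finset.mem_filter.2 ⟨ha, rfl⟩⟩
  by_cases h0 : a 0 = 0
  · refine sum_sign_mul_weight_ne_zero_of_corner (fun σ hσ => ?_) hS hsum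
    obtain ⟨hσF, hσ0⟩ := Finset.mem_filter.1 hσ
    exact ⟨hF σ hσF, hσ0.trans h0⟩
  · refine sum_sign_mul_weight_ne_zero_of_column h0 (fun σ hσ => ?_) hS hsum
    obtain ⟨hσF, hσ0⟩ := Finset.mem_filter.1 hσ
    refine ⟨hF σ hσF, hσ0, not_lt.1 fun hlt => ?_⟩
    refine vand_ne_zero_of_row hF (k := σ.symm 0) (fun hk => h0 ?_)
      (fun τ hτ _ => lt_of_lt_of_le hlt (hmin τ hτ)) hσF (σ.apply_symm_apply 0) h
    rw [← hσ0]
    simpa using ((Equiv.symm_apply_eq σ).1 hk).symm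

end Biwheel

/-- ASNC for biwheels: for `m ≥ 3`, any coloring `ρ` and target `t`, if the exact-`t`
fiber of the biwheel `B_{2m}` is nonempty, then its Vandermonde polynomial is nonzero. -/
theorem asnc_biwheel (m : ℕ) (hm : 3 ≤ m) (ρ : Fin m × Fin m → Fin 2) (t : ℕ)
    (hne : (fiber (biwheelEdges m) ρ t).Nonempty) :
    vand (fiber (biwheelEdges m) ρ t) ≠ 0 := by
  obtain ⟨n, rfl⟩ : ∃ n, m = n + 3 := ⟨m - 3, by omega⟩
  exact Biwheel.vand_ne_zero
    (fun σ hσ => Biwheel.isMatching_of_mem_pm (Finset.mem_filter.1 hσ).1) hne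
end
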